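/- Let Φ = {φ_n}_{n=1}^N ⊆ ℝ^M with each φ_n ≠ 0 and with Φ spanning ℝ^M, and define A : ℝ^M → ℝ^N by (A(x))(n) := |⟨x, φ_n⟩|². Then A is almost injective (A⁻¹(A(x)) = {x, −x} for Lebesgue-almost every x ∈ ℝ^M) if and only if for every nonempty proper subset S ⊆ {1,…,N}, the subspace span(Φ_S)^⊥ + span(Φ_{S^c})^⊥ is a proper subspace of ℝ^M. -/

import Mathlib

open Finset RealInnerProductSpace MeasureTheory

/-- Membership in the orthogonal complement of the span of an indexed image. -/
theorem mem_orthogonal_span_image_iff {ι E : Type*} [NormedAddCommGroup E] [InnerProductSpace ℝ E]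
    {Φ : ι → E} {S : Set ι} {x : E} :
    x ∈ (Submodule.span ℝ (Φ '' S))ᗮ ↔ ∀ n ∈ S, ⟪x, Φ n⟫ = 0 := by
  rw [Submodule.mem_orthogonal']
  refine ⟨fun h n hn => h _ (Submodule.subset_span ⟨n, hn, rfl⟩), fun h u hu => ?_⟩
  induction hu using Submodule.span_induction with
  | mem u hu => obtain ⟨n, hn, rfl⟩ := hu; exact h n hn
  | zero => exact inner_zero_right x
  | add u v _ _ hu hv => rw [inner_add_right, hu, hv, add_zero]
  | smul a u _ hu => rw [inner_smul_right, hu, mul_zero]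

theorem orthogonal_span_image_ne_top {ι E : Type*} [NormedAddCommGroup E] [InnerProductSpace ℝ E]
    {Φ : ι → E} {S : Set ι} {n : ι} (hn : n ∈ S) (h0 : Φ n ≠ 0) :
    (Submodule.span ℝ (Φ '' S))ᗮ ≠ ⊤ := fun h =>
  h0 (inner_self_eq_zero.1 (mem_orthogonal_span_image_iff.1 (h ▸ Submodule.mem_top) n hn))

theorem ae_notMem_submodule {E : Type*} [NormedAddCommGroup E] [NormedSpace ℝ E]
    [MeasurableSpace E] [BorelSpace E] [FiniteDimensional ℝ E] (μ : Measure E)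
    [μ.IsAddHaarMeasure] {V : Submodule ℝ E} (hV : V ≠ ⊤) : ∀ᵐ x ∂μ, x ∉ V :=
  measure_eq_zero_iff_ae_notMem.1 (Measure.addHaar_submodule μ V hV)

theorem eq_of_forall_inner_eq {ι E : Type*} [NormedAddCommGroup E] [InnerProductSpace ℝ E]
    {Φ : ι → E} (hspan : Submodule.span ℝ (Set.range Φ) = ⊤) {x y : E}
    (h : ∀ n, ⟪x, Φ n⟫ = ⟪y, Φ n⟫) : x = y := by
  have hmem : x - y ∈ (Submodule.span ℝ (Φ '' Set.univ))ᗮ :=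
    mem_orthogonal_span_image_iff.2 fun n _ => by rw [inner_sub_left, h, sub_self]
  rw [Set.image_univ, hspan, Submodule.top_orthogonal_eq_bot, Submodule.mem_bot] at hmem
  exact sub_eq_zero.1 hmem

theorem almost_injective_iff_Minkowski_proper (M N : ℕ)
    (Φ : Fin N → EuclideanSpace ℝ (Fin M))
    (hne : ∀ n, Φ n ≠ 0)
    (hspan : Submodule.span ℝ (Set.range Φ) = ⊤) :
    (∀ᵐ x ∂(volume : Measure (EuclideanSpace ℝ (Fin M))),
        ∀ y : EuclideanSpace ℝ (Fin M),
          (∀ n, |⟪y, Φ n⟫|^2 = |⟪x, Φ n⟫|^2) → y = x ∨ y = -x) ↔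
    (∀ S : Finset (Fin N), S ≠ ∅ → S ≠ Finset.univ →
        (Submodule.span ℝ (Φ '' ↑S))ᗮ ⊔ (Submodule.span ℝ (Φ '' ↑Sᶜ))ᗮ ≠ ⊤) := by
  constructor
  · intro hae S hS hS' htop
    obtain ⟨n, hn⟩ := Finset.nonempty_iff_ne_empty.2 hS
    obtain ⟨m, hm⟩ : ∃ m, m ∉ S := by
      by_contra! h
      exact hS' (Finset.eq_univ_iff_forall.2 h)
    have hU : (Submodule.span ℝ (Φ '' (S : Set (Fin N))))ᗮ ≠ ⊤ :=
      orthogonal_span_image_ne_top (Finset.mem_coe.2 hn) (hne n)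
    have hV : (Submodule.span ℝ (Φ '' ↑Sᶜ))ᗮ ≠ ⊤ :=
      orthogonal_span_image_ne_top (n := m) (by simpa using hm) (hne m)
    obtain ⟨x, hx, hxU, hxV⟩ := (hae.and
      ((ae_notMem_submodule volume hU).and (ae_notMem_submodule volume hV))).exists
    obtain ⟨u, hu, v, hv, rfl⟩ := Submodule.mem_sup.1 (htop ▸ Submodule.mem_top : x ∈ _ ⊔ _)
    have hu' := mem_orthogonal_span_image_iff.1 hu
    have hv' := mem_orthogonal_span_image_iff.1 hv
    rcases hx (u - v) fun k => by
      rw [sq_abs, sq_abs, inner_sub_left, inner_add_left]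
      by_cases hk : k ∈ S
      · rw [hu' k (by simpa using hk)]; ring
      · rw [hv' k (by simpa using hk)]; ring with h | h
    · have hv0 : v = 0 := by linear_combination (norm := module) (-1 / 2 : ℝ) • h
      exact hxU (by simpa [hv0] using hu)
    · have hu0 : u = 0 := by linear_combination (norm := module) (1 / 2 : ℝ) • h
      exact hxV (by simpa [hu0] using hv)
  · intro h
    have hae : ∀ᵐ x ∂(volume : Measure (EuclideanSpace ℝ (Fin M))), ∀ S : Finset (Fin N),
        S ≠ ∅ → S ≠ Finset.univ →
          x ∉ (Submodule.span ℝ (Φ '' ↑S))ᗮ ⊔ (Submodule.span ℝ (Φ '' ↑Sᶜ))ᗮ := by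
      simp only [ae_all_iff]
      exact fun S hS hS' => ae_notMem_submodule volume (h S hS hS')
    filter_upwards [hae] with x hx y hxy
    have hsign (n) : ⟪y, Φ n⟫ = ⟪x, Φ n⟫ ∨ ⟪y, Φ n⟫ = -⟪x, Φ n⟫ :=
      abs_eq_abs.1 ((sq_eq_sq₀ (abs_nonneg _) (abs_nonneg _)).1 (hxy n))
    classical
    let S : Finset (Fin N) := {n | ⟪y, Φ n⟫ = -⟪x, Φ n⟫}
    have hmem : x ∈ (Submodule.span ℝ (Φ '' ↑S))ᗮ ⊔ (Submodule.span ℝ (Φ '' ↑Sᶜ))ᗮ := by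
      refine Submodule.mem_sup.2 ⟨(2⁻¹ : ℝ) • (x + y), ?_, (2⁻¹ : ℝ) • (x - y), ?_, by module⟩
      · refine Submodule.smul_mem _ _ (mem_orthogonal_span_image_iff.2 fun n hn => ?_)
        have hn' : ⟪y, Φ n⟫ = -⟪x, Φ n⟫ := by simpa [S] using hn
        rw [inner_add_left, hn', add_neg_cancel]
      · refine Submodule.smul_mem _ _ (mem_orthogonal_span_image_iff.2 fun n hn => ?_)
        have hn' : ¬ ⟪y, Φ n⟫ = -⟪x, Φ n⟫ := by simpa [S] using hn
        rw [inner_sub_left, (hsign n).resolve_right hn', sub_self]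
    by_cases hS : S = ∅
    · refine Or.inl (eq_of_forall_inner_eq hspan fun n => (hsign n).resolve_right fun hn => ?_)
      exact Finset.notMem_empty n (hS ▸ (by simpa [S] using hn : n ∈ S))
    · have hS' : S = Finset.univ := by
        by_contra hS'
        exact hx S hS hS' hmem
      refine Or.inr (eq_of_forall_inner_eq hspan fun n => ?_)
      have hn : n ∈ S := hS' ▸ Finset.mem_univ n
      rw [inner_neg_left]
      simpa [S] using hn
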